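/- arXiv:math/0403463 — 5 statements merged into one kernel-verified Lean document; each statement's English description precedes it below -/
import Mathlib

section
/- Let γ and N be positive integers, let ω < 0 be a real number, let S be a finite subset of the strip { y ∈ ℂ : 0 < Im y < 2π/γ }, and let f : ℂ → ℂ be holomorphic on ℂ ∖ { s + 2πik/γ : s ∈ S, k ∈ ℤ } and satisfy f(y + 2πi/γ) = f(y) for all y in its domain. Set Φ(y) := f(y)·exp((N/2 − iω)y). Assume (i) the restriction of Φ to ℝ is Lebesgue-integrable, and (ii) for every integer M ≥ 1, ∫₀^{2πM/γ} |Φ(R + it)| dt → 0 and ∫₀^{2πM/γ} |Φ(−R + it)| dt → 0 as R → +∞. Then ∫_ℝ Φ(y) dy = 2πi · (1 − e^{π(iN+2ω)/γ})^{−1} · Σ_{s∈S} Res_s Φ, where Res_s Φ denotes the residue of Φ at s (note that |e^{π(iN+2ω)/γ}| = e^{2πω/γ} < 1, so the denominator does not vanish). -/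
open MeasureTheory Complex Filter Real

lemma path_ftc {c : ℂ} {R : ℝ} {g : ℂ → ℂ} {F : ℂ → ℂ}
    (hg : ContinuousOn g (Metric.ball c R))
    (hF : ∀ z ∈ Metric.ball c R, HasDerivAt F (g z) z) {p p' : ℝ → ℂ} {a b : ℝ} (hab : a ≤ b)
    (hp : ∀ t, HasDerivAt p (p' t) t) (hp' : Continuous p')
    (hmem : ∀ t ∈ Set.Icc a b, p t ∈ Metric.ball c R) :
    ∫ t in a..b, p' t * g (p t) = F (p b) - F (p a) := by
  have hpc : Continuous p := continuous_iff_continuousAt.2 fun t => (hp t).continuousAt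
  refine intervalIntegral.integral_eq_sub_of_hasDerivAt (f := fun t => F (p t)) ?_ ?_
  · intro t ht
    rw [Set.uIcc_of_le hab] at ht
    have := (hF _ (hmem t ht)).comp t (hp t)
    rw [mul_comm]
    exact this
  · apply ContinuousOn.intervalIntegrable
    rw [Set.uIcc_of_le hab]
    exact hp'.continuousOn.mul (hg.comp hpc.continuousOn hmem)

lemma sector_eq (g : ℂ → ℂ) (s : ℂ) (δ : ℝ) (hδ : 0 < δ)
    (hd : ∀ z, z ≠ s → dist z s < 4 * δ → DifferentiableAt ℂ g z) (α : ℝ) (u : ℂ)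
    (hu : Complex.exp (α * I) = u) :
    ∫ t in (-δ)..δ, (u * I) * g (s + u * (δ + t * I)) =
      ∫ θ in (α - π / 4)..(α + π / 4),
        deriv (circleMap s (√2 * δ)) θ • g (circleMap s (√2 * δ) θ) := by
  have hun : ‖u‖ = 1 := by rw [← hu]; exact Complex.norm_exp_ofReal_mul_I α
  have hdd : DifferentiableOn ℂ g (Metric.ball (s + u * (2 * δ : ℝ)) (2 * δ)) := by
    intro z hz
    refine (hd z ?_ ?_).differentiableWithinAt
    · rintro rfl
      rw [Metric.mem_ball, dist_eq_norm] at hz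
      simp only [sub_add_cancel_left, norm_neg, norm_mul, hun, one_mul, Complex.norm_real,
        Real.norm_eq_abs] at hz
      rw [abs_of_pos (by linarith)] at hz
      rw [abs_of_pos hδ] at hz
      exact lt_irrefl _ hz
    · have h1 : dist (s + u * (2 * δ : ℝ)) s = 2 * δ := by
        rw [dist_eq_norm, add_sub_cancel_left, norm_mul, hun, one_mul, Complex.norm_real,
          Real.norm_eq_abs, abs_of_pos (by linarith)]
      have h2 := dist_triangle z (s + u * (2 * δ : ℝ)) s
      rw [Metric.mem_ball] at hz
      linarith
  obtain ⟨F, hF⟩ := hdd.isExactOn_ball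
  have key : ∀ w : ℂ, Complex.normSq (w - (2 * δ : ℝ)) < (2 * δ) ^ 2 →
      s + u * w ∈ Metric.ball (s + u * (2 * δ : ℝ)) (2 * δ) := by
    intro w hw
    rw [Metric.mem_ball, dist_eq_norm, add_sub_add_left_eq_sub, ← mul_sub, norm_mul, hun, one_mul]
    rw [Complex.normSq_eq_norm_sq] at hw
    exact lt_of_pow_lt_pow_left₀ 2 (by linarith) hw
  have hcm : ∀ θ : ℝ, circleMap s (√2 * δ) θ =
      s + u * ((√2 * δ : ℝ) * Complex.exp ((θ - α : ℝ) * I)) := by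
    intro θ
    rw [circleMap, ← hu, mul_left_comm, ← Complex.exp_add]
    congr 3
    push_cast
    ring
  have h2 : √2 * √2 = 2 := Real.mul_self_sqrt (by norm_num)
  have h20 : 0 < √2 := by positivity
  have e1 := path_ftc hdd.continuousOn hF (p := fun t : ℝ => s + u * (δ + t * I))
    (p' := fun _ => u * I) (a := -δ) (b := δ) (by linarith)
    (by
      intro t
      have := ((((hasDerivAt_id t).ofReal_comp).mul_const I).const_add (δ : ℂ)).const_mul u
      simpa using this.const_add s) continuous_const
    (by
      intro t ht
      apply key
      simp only [Complex.normSq_apply]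
      simp
      nlinarith [ht.1, ht.2])
  have e2 := path_ftc hdd.continuousOn hF (p := circleMap s (√2 * δ))
    (p' := fun θ => deriv (circleMap s (√2 * δ)) θ) (a := α - π / 4) (b := α + π / 4)
    (by linarith [Real.pi_pos])
    (by
      intro t
      rw [deriv_circleMap]
      exact hasDerivAt_circleMap _ _ _)
    (by
      simp only [deriv_circleMap]
      exact (continuous_circleMap _ _).mul continuous_const)
    (by
      intro t ht
      rw [hcm]
      apply key
      have hc : √2 / 2 ≤ Real.cos (t - α) := by
        rw [← Real.cos_pi_div_four, ← Real.cos_abs (t - α)]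
        apply Real.cos_le_cos_of_nonneg_of_le_pi (abs_nonneg _) (by linarith [Real.pi_pos])
        rw [abs_le]
        constructor <;> linarith [ht.1, ht.2]
      simp only [Complex.normSq_apply, Complex.sub_re, Complex.sub_im, Complex.re_ofReal_mul,
        Complex.im_ofReal_mul, Complex.exp_ofReal_mul_I_re, Complex.exp_ofReal_mul_I_im,
        Complex.ofReal_re, Complex.ofReal_im]
      have hcs := Real.sin_sq_add_cos_sq (t - α)
      have h3 : 1 ≤ √2 * Real.cos (t - α) := by nlinarith
      have h4 : (√2 * δ * Real.cos (t - α) - 2 * δ) * (√2 * δ * Real.cos (t - α) - 2 * δ) +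
        (√2 * δ * Real.sin (t - α) - 0) * (√2 * δ * Real.sin (t - α) - 0) =
        (√2 * √2) * δ ^ 2 * (Real.sin (t - α) ^ 2 + Real.cos (t - α) ^ 2)
          - 4 * δ ^ 2 * (√2 * Real.cos (t - α)) + 4 * δ ^ 2 := by ring
      rw [h4, hcs, h2]
      have : 0 < δ ^ 2 := by positivity
      nlinarith)
  have hend1 : s + u * ((δ : ℂ) + (δ : ℝ) * I) = circleMap s (√2 * δ) (α + π / 4) := by
    rw [hcm, add_sub_cancel_left]
    congr 2
    apply Complex.ext
    · rw [Complex.re_ofReal_mul, Complex.exp_ofReal_mul_I_re, Real.cos_pi_div_four]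
      simp
      linear_combination (-δ / 2) * h2
    · rw [Complex.im_ofReal_mul, Complex.exp_ofReal_mul_I_im, Real.sin_pi_div_four]
      simp
      linear_combination (-δ / 2) * h2
  have hend2 : s + u * ((δ : ℂ) + (-δ : ℝ) * I) = circleMap s (√2 * δ) (α - π / 4) := by
    rw [hcm, show α - π / 4 - α = -(π / 4) by ring]
    congr 2
    apply Complex.ext
    · rw [Complex.re_ofReal_mul, Complex.exp_ofReal_mul_I_re, Real.cos_neg, Real.cos_pi_div_four]
      simp
      linear_combination (-δ / 2) * h2
    · rw [Complex.im_ofReal_mul, Complex.exp_ofReal_mul_I_im, Real.sin_neg, Real.sin_pi_div_four]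
      simp
      linear_combination (-δ / 2) * h2
  simp only [smul_eq_mul]
  rw [e1, e2, hend1, hend2]

noncomputable def rectI (g : ℂ → ℂ) (a b c d : ℝ) : ℂ :=
  (∫ x in a..b, g (x + c * I)) - (∫ x in a..b, g (x + d * I)) +
    I * (∫ y in c..d, g (b + y * I)) - I * ∫ y in c..d, g (a + y * I)

lemma square_eq (g : ℂ → ℂ) (s : ℂ) (δ : ℝ) (hδ : 0 < δ)
    (hd : ∀ z, z ≠ s → dist z s < 4 * δ → DifferentiableAt ℂ g z) :
    rectI g (s.re - δ) (s.re + δ) (s.im - δ) (s.im + δ) = ∮ z in C(s, √2 * δ), g z := by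
  have hs : s = s.re + s.im * I := (Complex.re_add_im s).symm
  have k0 := sector_eq g s δ hδ hd 0 1 (by simp)
  have k1 := sector_eq g s δ hδ hd (π / 2) I (by
    push_cast; exact Complex.exp_pi_div_two_mul_I)
  have k2 := sector_eq g s δ hδ hd π (-1) (by exact Complex.exp_pi_mul_I)
  have k3 := sector_eq g s δ hδ hd (π / 2 + π) (-I) (by
    push_cast; rw [add_mul, Complex.exp_add, Complex.exp_pi_mul_I, Complex.exp_pi_div_two_mul_I]; ring)
  have r0 : 0 < √2 * δ := by positivity
  have hr : √2 * δ < 4 * δ := by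
    have : √2 < 4 := by
      rw [Real.sqrt_lt' (by norm_num)]; norm_num
    nlinarith
  have hcont : Continuous fun θ : ℝ =>
      deriv (circleMap s (√2 * δ)) θ • g (circleMap s (√2 * δ) θ) := by
    simp only [deriv_circleMap]
    refine ((continuous_circleMap _ _).mul continuous_const).smul ?_
    rw [continuous_iff_continuousAt]
    intro θ
    have h1 : DifferentiableAt ℂ g (circleMap s (√2 * δ) θ) := by
      apply hd
      · exact circleMap_ne_center r0.ne'
      · rw [dist_eq_norm]
        simp only [circleMap, add_sub_cancel_left, norm_mul, Complex.norm_exp_ofReal_mul_I,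
          Complex.norm_real, Real.norm_eq_abs, mul_one]
        rw [abs_of_pos (by positivity), abs_of_pos hδ]
        exact hr
    exact ContinuousAt.comp (f := circleMap s (√2 * δ)) h1.continuousAt
      (continuous_circleMap _ _).continuousAt
  have hii : ∀ a b : ℝ, IntervalIntegrable (fun θ : ℝ =>
      deriv (circleMap s (√2 * δ)) θ • g (circleMap s (√2 * δ) θ)) volume a b :=
    fun a b => hcont.intervalIntegrable a b
  have hper : Function.Periodic (fun θ : ℝ =>
      deriv (circleMap s (√2 * δ)) θ • g (circleMap s (√2 * δ) θ)) (2 * π) := by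
    intro θ
    simp only [deriv_circleMap]
    rw [periodic_circleMap, periodic_circleMap]
  have htot := hper.intervalIntegral_add_eq 0 (0 - π / 4)
  rw [circleIntegral]
  rw [zero_add] at htot
  rw [htot, ← intervalIntegral.integral_add_adjacent_intervals (hii (0 - π / 4) (0 + π / 4)) (hii _ _),
    ← intervalIntegral.integral_add_adjacent_intervals (hii (0 + π / 4) (π / 2 + π / 4)) (hii _ _),
    ← intervalIntegral.integral_add_adjacent_intervals (hii (π / 2 + π / 4) (π + π / 4)) (hii _ _)]
  rw [show π / 2 - π / 4 = 0 + π / 4 by ring] at k1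
  rw [show π - π / 4 = π / 2 + π / 4 by ring] at k2
  rw [show π / 2 + π - π / 4 = π + π / 4 by ring,
    show π / 2 + π + π / 4 = 0 - π / 4 + 2 * π by ring] at k3
  rw [← k0, ← k1, ← k2, ← k3]
  simp only [intervalIntegral.integral_const_mul]
  have j0 : ∫ t in (-δ)..δ, g (s + 1 * (δ + t * I)) =
      ∫ y in (s.im - δ)..(s.im + δ), g ((s.re + δ : ℝ) + y * I) := by
    rw [sub_eq_add_neg, ← intervalIntegral.integral_comp_add_left
      (fun y : ℝ => g ((s.re + δ : ℝ) + y * I))]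
    congr 1; ext t; congr 1
    conv_lhs => rw [hs]
    push_cast; ring
  have j1 : ∫ t in (-δ)..δ, g (s + I * (δ + t * I)) =
      ∫ x in (s.re - δ)..(s.re + δ), g (x + (s.im + δ : ℝ) * I) := by
    rw [← sub_neg_eq_add s.re δ, ← intervalIntegral.integral_comp_sub_left
      (fun x : ℝ => g (x + (s.im + δ : ℝ) * I))]
    congr 1; ext t; congr 1
    conv_lhs => rw [hs]
    push_cast; linear_combination (t : ℂ) * I_sq
  have j2 : ∫ t in (-δ)..δ, g (s + (-1) * (δ + t * I)) =
      ∫ y in (s.im - δ)..(s.im + δ), g ((s.re - δ : ℝ) + y * I) := by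
    rw [← sub_neg_eq_add s.im δ, ← intervalIntegral.integral_comp_sub_left
      (fun y : ℝ => g ((s.re - δ : ℝ) + y * I))]
    congr 1; ext t; congr 1
    conv_lhs => rw [hs]
    push_cast; ring
  have j3 : ∫ t in (-δ)..δ, g (s + (-I) * (δ + t * I)) =
      ∫ x in (s.re - δ)..(s.re + δ), g (x + (s.im - δ : ℝ) * I) := by
    rw [sub_eq_add_neg s.re δ, ← intervalIntegral.integral_comp_add_left
      (fun x : ℝ => g (x + (s.im - δ : ℝ) * I))]
    congr 1; ext t; congr 1
    conv_lhs => rw [hs]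
    push_cast; linear_combination -(t : ℂ) * I_sq
  rw [j0, j1, j2, j3, rectI, I_mul_I]
  linear_combination (∫ x in (s.re - δ)..(s.re + δ), g (x + (s.im - δ : ℝ) * I)) * I_sq

lemma hInt {g : ℂ → ℂ} {a b c : ℝ} (hab : a ≤ b)
    (h : ∀ x : ℝ, a ≤ x → x ≤ b → DifferentiableAt ℂ g (x + c * I)) :
    IntervalIntegrable (fun x : ℝ => g (x + c * I)) volume a b := by
  apply ContinuousOn.intervalIntegrable
  rw [Set.uIcc_of_le hab]
  intro x hx
  refine ContinuousAt.continuousWithinAt ?_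
  exact ContinuousAt.comp (f := fun x : ℝ => (x + c * I : ℂ)) (h x hx.1 hx.2).continuousAt
    (by fun_prop)

lemma vInt {g : ℂ → ℂ} {a c d : ℝ} (hcd : c ≤ d)
    (h : ∀ y : ℝ, c ≤ y → y ≤ d → DifferentiableAt ℂ g (a + y * I)) :
    IntervalIntegrable (fun y : ℝ => g (a + y * I)) volume c d := by
  apply ContinuousOn.intervalIntegrable
  rw [Set.uIcc_of_le hcd]
  intro x hx
  refine ContinuousAt.continuousWithinAt ?_
  exact ContinuousAt.comp (f := fun y : ℝ => (a + y * I : ℂ)) (h x hx.1 hx.2).continuousAt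
    (by fun_prop)

lemma rectI_split_re {g : ℂ → ℂ} {a m b c d : ℝ} (ham : a ≤ m) (hmb : m ≤ b)
    (h1 : ∀ x : ℝ, a ≤ x → x ≤ b → DifferentiableAt ℂ g (x + c * I))
    (h2 : ∀ x : ℝ, a ≤ x → x ≤ b → DifferentiableAt ℂ g (x + d * I)) :
    rectI g a b c d = rectI g a m c d + rectI g m b c d := by
  have e1 := intervalIntegral.integral_add_adjacent_intervals
    (hInt ham fun x hx hx' => h1 x hx (hx'.trans hmb))
    (hInt hmb fun x hx hx' => h1 x (ham.trans hx) hx')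
  have e2 := intervalIntegral.integral_add_adjacent_intervals
    (hInt ham fun x hx hx' => h2 x hx (hx'.trans hmb))
    (hInt hmb fun x hx hx' => h2 x (ham.trans hx) hx')
  simp only [rectI]
  rw [← e1, ← e2]
  ring

lemma rectI_split_im {g : ℂ → ℂ} {a b c m d : ℝ} (hcm : c ≤ m) (hmd : m ≤ d)
    (h1 : ∀ y : ℝ, c ≤ y → y ≤ d → DifferentiableAt ℂ g (a + y * I))
    (h2 : ∀ y : ℝ, c ≤ y → y ≤ d → DifferentiableAt ℂ g (b + y * I)) :
    rectI g a b c d = rectI g a b c m + rectI g a b m d := by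
  have e1 := intervalIntegral.integral_add_adjacent_intervals
    (vInt hcm fun x hx hx' => h1 x hx (hx'.trans hmd))
    (vInt hmd fun x hx hx' => h1 x (hcm.trans hx) hx')
  have e2 := intervalIntegral.integral_add_adjacent_intervals
    (vInt hcm fun x hx hx' => h2 x hx (hx'.trans hmd))
    (vInt hmd fun x hx hx' => h2 x (hcm.trans hx) hx')
  simp only [rectI]
  rw [← e1, ← e2]
  ring

lemma rectI_zero {g : ℂ → ℂ} {a b c d : ℝ} (hab : a ≤ b) (hcd : c ≤ d)
    (h : ∀ z : ℂ, a ≤ z.re → z.re ≤ b → c ≤ z.im → z.im ≤ d → DifferentiableAt ℂ g z) :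
    rectI g a b c d = 0 := by
  have := Complex.integral_boundary_rect_eq_zero_of_differentiableOn g ⟨a, c⟩ ⟨b, d⟩ (by
    intro z hz
    rw [Complex.mem_reProdIm] at hz
    simp only [Set.uIcc_of_le hab, Set.uIcc_of_le hcd] at hz
    exact (h z hz.1.1 hz.1.2 hz.2.1 hz.2.2).differentiableWithinAt)
  simpa [rectI] using this

lemma rectI_singleton {g : ℂ → ℂ} {a b c d : ℝ} {s A : ℂ}
    (hs : a < s.re ∧ s.re < b ∧ c < s.im ∧ s.im < d)
    (h : ∀ z : ℂ, a ≤ z.re → z.re ≤ b → c ≤ z.im → z.im ≤ d → z ≠ s → DifferentiableAt ℂ g z)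
    (hA : ∃ ε > 0, ∀ r : ℝ, 0 < r → r < ε → (∮ z in C(s, r), g z) = A) :
    rectI g a b c d = A := by
  obtain ⟨ε, hε, hA⟩ := hA
  obtain ⟨h1, h2, h3, h4⟩ := hs
  obtain ⟨e, he, e0, e1, e2, e3, e4⟩ : ∃ e : ℝ, 0 < e ∧ e ≤ ε ∧ e ≤ s.re - a ∧ e ≤ b - s.re ∧
      e ≤ s.im - c ∧ e ≤ d - s.im := by
    refine ⟨min ε (min (s.re - a) (min (b - s.re) (min (s.im - c) (d - s.im)))), ?_, ?_⟩
    · simp only [lt_min_iff]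
      refine ⟨hε, ?_, ?_, ?_, ?_⟩ <;> linarith
    · simp only [min_le_iff, le_refl, true_or, or_true, and_self]
  obtain ⟨δ, hδ, rfl⟩ : ∃ δ : ℝ, 0 < δ ∧ e = 4 * δ := ⟨e / 4, by linarith, by ring⟩
  have ne_re : ∀ z : ℂ, z.re ≠ s.re → z ≠ s := fun z hz h => hz (by rw [h])
  have ne_im : ∀ z : ℂ, z.im ≠ s.im → z ≠ s := fun z hz h => hz (by rw [h])
  have sq := square_eq g s δ hδ (by
    intro z hz hdist
    rw [dist_eq_norm] at hdist
    have t1 := (abs_le.1 (Complex.abs_re_le_norm (z - s)))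
    have t2 := (abs_le.1 (Complex.abs_im_le_norm (z - s)))
    simp only [Complex.sub_re, Complex.sub_im] at t1 t2
    exact h z (by linarith [t1.1]) (by linarith [t1.2]) (by linarith [t2.1]) (by linarith [t2.2]) hz)
  have hr : √2 * δ < 4 * δ := by
    have : √2 < 4 := by
      rw [Real.sqrt_lt' (by norm_num)]; norm_num
    nlinarith
  rw [hA _ (by positivity) (by linarith)] at sq
  have dh : ∀ x y : ℝ, a ≤ x → x ≤ b → c ≤ y → y ≤ d → (x ≠ s.re ∨ y ≠ s.im) →
      DifferentiableAt ℂ g (x + y * I) := by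
    intro x y hx hx' hy hy' hne
    apply h <;> try simpa
    rcases hne with hne | hne
    · exact ne_re _ (by simpa using hne)
    · exact ne_im _ (by simpa using hne)
  rw [rectI_split_re (m := s.re - δ) (by linarith) (by linarith)
      (fun x hx hx' => dh x c hx hx' (by linarith) (by linarith) (Or.inr h3.ne))
      (fun x hx hx' => dh x d hx hx' (by linarith) (by linarith) (Or.inr h4.ne')),
    rectI_split_re (a := s.re - δ) (m := s.re + δ) (by linarith) (by linarith)
      (fun x hx hx' => dh x c (by linarith) hx' (by linarith) (by linarith) (Or.inr h3.ne))
      (fun x hx hx' => dh x d (by linarith) hx' (by linarith) (by linarith) (Or.inr h4.ne')),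
    rectI_split_im (a := s.re - δ) (b := s.re + δ) (m := s.im - δ) (by linarith) (by linarith)
      (fun y hy hy' => dh _ y (by linarith) (by linarith) hy hy' (Or.inl (by linarith)))
      (fun y hy hy' => dh _ y (by linarith) (by linarith) hy hy' (Or.inl (by linarith))),
    rectI_split_im (a := s.re - δ) (b := s.re + δ) (c := s.im - δ) (m := s.im + δ)
      (by linarith) (by linarith)
      (fun y hy hy' => dh _ y (by linarith) (by linarith) (by linarith) hy' (Or.inl (by linarith)))
      (fun y hy hy' => dh _ y (by linarith) (by linarith) (by linarith) hy' (Or.inl (by linarith))),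
    sq,
    rectI_zero (a := a) (b := s.re - δ) (by linarith) (by linarith) (fun z hz1 hz2 hz3 hz4 =>
      h z (by linarith) (by linarith) (by linarith) (by linarith) (ne_re z (by linarith))),
    rectI_zero (a := s.re + δ) (b := b) (by linarith) (by linarith) (fun z hz1 hz2 hz3 hz4 =>
      h z (by linarith) (by linarith) (by linarith) (by linarith) (ne_re z (by linarith))),
    rectI_zero (c := c) (d := s.im - δ) (by linarith) (by linarith) (fun z hz1 hz2 hz3 hz4 =>
      h z (by linarith) (by linarith) (by linarith) (by linarith) (ne_im z (by linarith))),
    rectI_zero (c := s.im + δ) (d := d) (by linarith) (by linarith) (fun z hz1 hz2 hz3 hz4 =>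
      h z (by linarith) (by linarith) (by linarith) (by linarith) (ne_im z (by linarith)))]
  ring

lemma exists_cut (T : Finset ℝ) {x y : ℝ} (h : x < y) : ∃ m, x < m ∧ m < y ∧ m ∉ T := by
  obtain ⟨m, hm, hmT⟩ := (Set.Ioo_infinite h).exists_notMem_finset T
  exact ⟨m, hm.1, hm.2, hmT⟩

lemma rect_residue (g A : ℂ → ℂ) (S : Finset ℂ) : ∀ a b c d : ℝ, a ≤ b → c ≤ d →
    (∀ s ∈ S, a < s.re ∧ s.re < b ∧ c < s.im ∧ s.im < d) →
    (∀ z : ℂ, a ≤ z.re → z.re ≤ b → c ≤ z.im → z.im ≤ d → z ∉ S → DifferentiableAt ℂ g z) →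
    (∀ s ∈ S, ∃ ε > 0, ∀ r : ℝ, 0 < r → r < ε → (∮ z in C(s, r), g z) = A s) →
    rectI g a b c d = ∑ s ∈ S, A s := by
  classical
  induction S using Finset.strongInduction with
  | H S ih =>
  intro a b c d hab hcd hS h hA
  have dh : ∀ x y : ℝ, a ≤ x → x ≤ b → c ≤ y → y ≤ d → (x + y * I : ℂ) ∉ S →
      DifferentiableAt ℂ g (x + y * I) := by
    intro x y hx hx' hy hy' hne
    apply h <;> first | exact hne | simpa
  have cre : ∀ p ∈ S, ∀ q ∈ S, p.re < q.re → rectI g a b c d = ∑ s ∈ S, A s := by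
    intro p hp q hq hpq
    obtain ⟨m, hm1, hm2, hmS⟩ := exists_cut (S.image Complex.re) hpq
    have hne : ∀ s ∈ S, s.re ≠ m := fun s hs e => hmS (Finset.mem_image.2 ⟨s, hs, e⟩)
    have ham : a ≤ m := by linarith [hS p hp]
    have hmb : m ≤ b := by linarith [hS q hq]
    rw [rectI_split_re ham hmb
      (fun x hx hx' => dh x c hx hx' le_rfl hcd fun hs => by simpa using (hS _ hs).2.2.1)
      (fun x hx hx' => dh x d hx hx' hcd le_rfl fun hs => by simpa using (hS _ hs).2.2.2),
      ← Finset.sum_filter_add_sum_filter_not S (fun s => s.re < m)]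
    congr 1
    · refine ih _ (Finset.filter_ssubset.2 ⟨q, hq, by linarith⟩) _ _ _ _ ham hcd ?_ ?_ ?_
      · intro s hs
        rw [Finset.mem_filter] at hs
        have := hS s hs.1
        exact ⟨this.1, hs.2, this.2.2⟩
      · intro z h1 h2 h3 h4 hz
        refine h z h1 (h2.trans hmb) h3 h4 fun hzS => hz ?_
        exact Finset.mem_filter.2 ⟨hzS, lt_of_le_of_ne h2 (hne z hzS)⟩
      · exact fun s hs => hA s (Finset.mem_filter.1 hs).1
    · refine ih _ (Finset.filter_ssubset.2 ⟨p, hp, by simpa using hm1⟩) _ _ _ _ hmb hcd ?_ ?_ ?_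
      · intro s hs
        rw [Finset.mem_filter] at hs
        have := hS s hs.1
        exact ⟨lt_of_le_of_ne (not_lt.1 hs.2) (hne s hs.1).symm, this.2⟩
      · intro z h1 h2 h3 h4 hz
        refine h z (ham.trans h1) h2 h3 h4 fun hzS => hz ?_
        exact Finset.mem_filter.2 ⟨hzS, not_lt.2 h1⟩
      · exact fun s hs => hA s (Finset.mem_filter.1 hs).1
  have cim : ∀ p ∈ S, ∀ q ∈ S, p.im < q.im → rectI g a b c d = ∑ s ∈ S, A s := by
    intro p hp q hq hpq
    obtain ⟨m, hm1, hm2, hmS⟩ := exists_cut (S.image Complex.im) hpq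
    have hne : ∀ s ∈ S, s.im ≠ m := fun s hs e => hmS (Finset.mem_image.2 ⟨s, hs, e⟩)
    have ham : c ≤ m := by linarith [hS p hp]
    have hmb : m ≤ d := by linarith [hS q hq]
    rw [rectI_split_im ham hmb
      (fun x hx hx' => dh a x le_rfl hab hx hx' fun hs => by simpa using (hS _ hs).1)
      (fun x hx hx' => dh b x hab le_rfl hx hx' fun hs => by simpa using (hS _ hs).2.1),
      ← Finset.sum_filter_add_sum_filter_not S (fun s => s.im < m)]
    congr 1
    · refine ih _ (Finset.filter_ssubset.2 ⟨q, hq, by linarith⟩) _ _ _ _ hab ham ?_ ?_ ?_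
      · intro s hs
        rw [Finset.mem_filter] at hs
        have := hS s hs.1
        exact ⟨this.1, this.2.1, this.2.2.1, hs.2⟩
      · intro z h1 h2 h3 h4 hz
        refine h z h1 h2 h3 (h4.trans hmb) fun hzS => hz ?_
        exact Finset.mem_filter.2 ⟨hzS, lt_of_le_of_ne h4 (hne z hzS)⟩
      · exact fun s hs => hA s (Finset.mem_filter.1 hs).1
    · refine ih _ (Finset.filter_ssubset.2 ⟨p, hp, by simpa using hm1⟩) _ _ _ _ hab hmb ?_ ?_ ?_
      · intro s hs
        rw [Finset.mem_filter] at hs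
        have := hS s hs.1
        exact ⟨this.1, this.2.1, lt_of_le_of_ne (not_lt.1 hs.2) (hne s hs.1).symm, this.2.2.2⟩
      · intro z h1 h2 h3 h4 hz
        refine h z h1 h2 (ham.trans h3) h4 fun hzS => hz ?_
        exact Finset.mem_filter.2 ⟨hzS, not_lt.2 h3⟩
      · exact fun s hs => hA s (Finset.mem_filter.1 hs).1
  rcases S.eq_empty_or_nonempty with rfl | ⟨p, hp⟩
  · rw [Finset.sum_empty]
    exact rectI_zero hab hcd fun z h1 h2 h3 h4 => h z h1 h2 h3 h4 (by simp)
  · by_cases hone : ∀ q ∈ S, q = p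
    · have hSp : S = {p} := Finset.eq_singleton_iff_unique_mem.2 ⟨hp, hone⟩
      rw [hSp, Finset.sum_singleton]
      exact rectI_singleton (hS p hp)
        (fun z h1 h2 h3 h4 hz => h z h1 h2 h3 h4 (by rw [hSp]; simpa using hz)) (hA p hp)
    · push Not at hone
      obtain ⟨q, hq, hqp⟩ := hone
      rcases lt_trichotomy p.re q.re with h1 | h1 | h1
      · exact cre p hp q hq h1
      · rcases lt_trichotomy p.im q.im with h2 | h2 | h2
        · exact cim p hp q hq h2
        · exact absurd (Complex.ext h1.symm h2.symm) hqp
        · exact cim q hq p hp h2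
      · exact cre q hq p hp h1

/-- Formula (5.12): the integral over `ℝ` of `Φ(y) = f(y)·e^((N/2 − iω)y)`, where `f` is
holomorphic away from the lattice of poles `s + 2πik/γ` (`s ∈ S`, `k ∈ ℤ`) and periodic
with period `2πi/γ`, equals `2πi (1 − e^(π(iN+2ω)/γ))⁻¹ Σ_{s∈S} Res_s Φ`; here the
residue `Res s` is characterized by integrals over small positively oriented circles. -/
theorem fourier_transform_by_residues
    (γ N : ℕ) (hγ : 0 < γ) (hN : 0 < N) (ω : ℝ) (hω : ω < 0)
    (S : Finset ℂ) (hS : ∀ s ∈ S, 0 < s.im ∧ s.im < 2 * π / γ)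
    (P : Set ℂ) (hP : P = {z : ℂ | ∃ s ∈ S, ∃ k : ℤ, z = s + 2 * π * Complex.I * k / γ})
    (f : ℂ → ℂ)
    (hf : ∀ z ∉ P, DifferentiableAt ℂ f z)
    (hper : ∀ z ∉ P, f (z + 2 * π * Complex.I / γ) = f z)
    (Φ : ℂ → ℂ)
    (hΦ : ∀ z : ℂ, Φ z = f z * Complex.exp (((N : ℂ) / 2 - Complex.I * ω) * z))
    (hint : Integrable (fun y : ℝ => Φ (y : ℂ)))
    (hdecay : ∀ M : ℕ, 1 ≤ M →
      Tendsto (fun R : ℝ => ∫ t in (0 : ℝ)..(2 * π * M / γ), ‖Φ ((R : ℂ) + t * Complex.I)‖)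
        atTop (nhds 0) ∧
      Tendsto (fun R : ℝ => ∫ t in (0 : ℝ)..(2 * π * M / γ), ‖Φ ((-R : ℂ) + t * Complex.I)‖)
        atTop (nhds 0))
    (Res : ℂ → ℂ)
    (hRes : ∀ s ∈ S, ∃ ε > 0, ∀ r : ℝ, 0 < r → r < ε →
      (∮ z in C(s, r), Φ z) = 2 * π * Complex.I * Res s) :
    ∫ y : ℝ, Φ (y : ℂ)
      = 2 * π * Complex.I * (1 - Complex.exp (π * (Complex.I * N + 2 * ω) / γ))⁻¹ *
        ∑ s ∈ S, Res s := by
  have hγ0 : (0 : ℝ) < γ := by exact_mod_cast hγ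
  have hγc : (γ : ℂ) ≠ 0 := by exact_mod_cast hγ.ne'
  have hT : 0 < 2 * π / γ := by positivity
  set T : ℝ := 2 * π / γ with hTdef
  have hTc : (T : ℂ) * I = 2 * π * Complex.I / γ := by
    rw [hTdef]; push_cast; ring
  -- the poles in the closed strip are the points of `S`
  have hPS : ∀ z : ℂ, 0 ≤ z.im → z.im ≤ T → z ∉ S → z ∉ P := by
    intro z h0 h1 hzS hzP
    rw [hP] at hzP
    obtain ⟨s, hs, k, hz⟩ := hzP
    have him : z.im = s.im + T * k := by
      have : z = s + ((T * k : ℝ) : ℂ) * I := by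
        rw [hz, hTdef]; push_cast; ring
      rw [this]; simp
    obtain ⟨hs0, hs1⟩ := hS s hs
    have hk1 : k < 1 := by
      by_contra hk
      have : (1 : ℝ) ≤ k := by exact_mod_cast not_lt.1 hk
      nlinarith
    have hk2 : -1 < k := by
      by_contra hk
      have : (k : ℝ) ≤ -1 := by exact_mod_cast not_lt.1 hk
      nlinarith
    have hk : k = 0 := by omega
    subst hk
    apply hzS
    rw [hz]
    simpa using hs
  have hΦd : ∀ z : ℂ, z ∉ P → DifferentiableAt ℂ Φ z := by
    intro z hz
    have : Φ = fun z => f z * Complex.exp (((N : ℂ) / 2 - Complex.I * ω) * z) := funext hΦ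
    rw [this]
    exact (hf z hz).mul (by fun_prop)
  set q : ℂ := Complex.exp (π * (Complex.I * N + 2 * ω) / γ) with hq
  have hshift : ∀ x : ℝ, Φ (x + (T : ℝ) * I) = q * Φ x := by
    intro x
    have hx : (x : ℂ) ∉ P := hPS x (by simp) (by simpa using hT.le) (by
      intro hs; simpa using (hS _ hs).1)
    rw [hΦ, hΦ, hTc, hper _ hx, hq, mul_left_comm, ← Complex.exp_add]
    congr 2
    field_simp
    linear_combination (-4 * π * ω : ℂ) * I_sq
  have hq1 : 1 - q ≠ 0 := by
    intro h
    have h1 : ‖q‖ = 1 := by rw [← sub_eq_zero.1 h]; simp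
    rw [hq, Complex.norm_exp, Real.exp_eq_one_iff] at h1
    have h2 : (π * (Complex.I * N + 2 * ω) / γ : ℂ) =
        ((2 * π * ω / γ : ℝ) : ℂ) + ((π * N / γ : ℝ) : ℂ) * I := by
      push_cast; ring
    rw [h2] at h1
    simp only [Complex.add_re, Complex.ofReal_re, Complex.re_ofReal_mul, Complex.I_re, mul_zero,
      add_zero] at h1
    have h3 : 2 * π * ω / γ < 0 := by
      apply div_neg_of_neg_of_pos _ hγ0
      nlinarith [Real.pi_pos]
    linarith
  -- residue theorem on large rectangles
  have hrect : ∀ᶠ R : ℝ in atTop,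
      rectI Φ (-R) R 0 T = ∑ s ∈ S, 2 * π * Complex.I * Res s := by
    have hbig : ∀ᶠ R : ℝ in atTop, ∀ s ∈ S, |s.re| < R := by
      rw [Filter.eventually_all_finset]
      exact fun s _ => eventually_gt_atTop _
    filter_upwards [hbig, eventually_ge_atTop 0] with R hR hR0
    refine rect_residue Φ (fun s => 2 * π * Complex.I * Res s) S (-R) R 0 T (by linarith) hT.le
      ?_ ?_ hRes
    · intro s hs
      have := abs_lt.1 (hR s hs)
      exact ⟨this.1, this.2, hS s hs⟩
    · intro z _ _ h3 h4 hz
      exact hΦd z (hPS z h3 h4 hz)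
  -- the limit of the rectangle integrals
  have hv1 : Tendsto (fun R : ℝ => ∫ y in (0 : ℝ)..T, Φ (R + y * I)) atTop (nhds 0) := by
    have h := (hdecay 1 le_rfl).1
    simp only [Nat.cast_one, mul_one] at h
    refine squeeze_zero_norm (fun R => ?_) h
    exact intervalIntegral.norm_integral_le_integral_norm hT.le
  have hv2 : Tendsto (fun R : ℝ => ∫ y in (0 : ℝ)..T, Φ ((-R : ℝ) + y * I)) atTop (nhds 0) := by
    have h := (hdecay 1 le_rfl).2
    simp only [Nat.cast_one, mul_one] at h
    refine squeeze_zero_norm (fun R => ?_) h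
    push_cast
    exact intervalIntegral.norm_integral_le_integral_norm hT.le
  have hh : Tendsto (fun R : ℝ => ∫ x in (-R)..R, Φ (x : ℂ)) atTop (nhds (∫ y : ℝ, Φ (y : ℂ))) :=
    intervalIntegral_tendsto_integral hint tendsto_neg_atTop_atBot tendsto_id
  have hlim : Tendsto (fun R : ℝ => rectI Φ (-R) R 0 T) atTop
      (nhds ((1 - q) * (∫ y : ℝ, Φ (y : ℂ)) + I * 0 - I * 0)) := by
    have := ((hh.const_mul (1 - q)).add (hv1.const_mul I)).sub (hv2.const_mul I)
    refine this.congr fun R => ?_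
    simp only [rectI, hshift, intervalIntegral.integral_const_mul]
    simp only [Complex.ofReal_zero, zero_mul, add_zero]
    ring
  have hconst : Tendsto (fun R : ℝ => rectI Φ (-R) R 0 T) atTop
      (nhds (∑ s ∈ S, 2 * π * Complex.I * Res s)) :=
    tendsto_const_nhds.congr' (hrect.mono fun R h => h.symm)
  have heq := tendsto_nhds_unique hlim hconst
  rw [← Finset.mul_sum] at heq
  field_simp
  linear_combination heq
end

section
/- With the notation of the context (h > 0, q = e^h, positive integers N, γ with N/γ an odd integer, β ∈ {0, 1/2}, a > 0, b ∈ ℝ, y_j = h(j+β) + iπ/γ), the function A_j^{a,b} takes purely imaginary values: for every y ∈ ℝ one has conj(A_j^{a,b}(y)) = − A_j^{a,b}(y). -/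
open MeasureTheory Complex Real

/-- The pole location `y_j = h(j+β) + iπ/γ`. -/
noncomputable def poleY (h β : ℝ) (γ : ℕ) (j : ℤ) : ℂ :=
  ((h * (j + β) : ℝ) : ℂ) + Complex.I * Real.pi / γ

/-- `A_j^{a,b}(y) = ∫ exp((N/2)·conj(y_j) + iω(conj(y_j)−y)) · exp(−ah(ω+ib)²) ·
(1 − exp((π/γ)(2ω−iN)))⁻¹ dω`. -/
noncomputable def Afun (h : ℝ) (N γ : ℕ) (β a b : ℝ) (j : ℤ) (y : ℝ) : ℂ :=
  ∫ ω : ℝ,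
    Complex.exp ((N : ℂ) / 2 * (starRingEnd ℂ) (poleY h β γ j)
        + Complex.I * ω * ((starRingEnd ℂ) (poleY h β γ j) - y))
      * Complex.exp (-(a * h) * ((ω : ℂ) + Complex.I * b) ^ 2)
      * (1 - Complex.exp (((Real.pi / γ : ℝ) : ℂ) * (2 * ω - Complex.I * N)))⁻¹

/-- `B_j^{a,b}(y) = ∫ exp((N/2)·y_j − iω(y_j−y)) · exp(−ah(ω−ib)²) ·
(1 − exp((π/γ)(2ω+iN)))⁻¹ dω`. -/
noncomputable def Bfun (h : ℝ) (N γ : ℕ) (β a b : ℝ) (j : ℤ) (y : ℝ) : ℂ :=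
  ∫ ω : ℝ,
    Complex.exp ((N : ℂ) / 2 * poleY h β γ j
        - Complex.I * ω * (poleY h β γ j - y))
      * Complex.exp (-(a * h) * ((ω : ℂ) - Complex.I * b) ^ 2)
      * (1 - Complex.exp (((Real.pi / γ : ℝ) : ℂ) * (2 * ω + Complex.I * N)))⁻¹

/-- The function `A_j^{a,b}` takes purely imaginary values. -/
theorem Afun_purely_imaginary
    (h : ℝ) (hh : 0 < h) (N γ : ℕ) (hN : 0 < N) (hγ : 0 < γ)
    (hodd : ∃ p : ℕ, Odd p ∧ N = γ * p)
    (β : ℝ) (hβ : β = 0 ∨ β = 1 / 2)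
    (a b : ℝ) (ha : 0 < a) (j : ℤ) :
    ∀ y : ℝ, (starRingEnd ℂ) (Afun h N γ β a b j y) = - Afun h N γ β a b j y := by
  intro y
  unfold Afun
  rw [← integral_conj, ← integral_neg, ← integral_neg_eq_self]
  congr 1
  funext ω
  have key : ∀ u : ℂ, (1 - Complex.exp u)⁻¹ = -(Complex.exp (-u) * (1 - Complex.exp (-u))⁻¹) := by
    intro u
    have hu := Complex.exp_ne_zero u
    rw [Complex.exp_neg]
    by_cases h1 : Complex.exp u = 1
    · simp [h1]
    · have h2 : 1 - Complex.exp u ≠ 0 := sub_ne_zero.mpr (Ne.symm h1)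
      have h3 : 1 - (Complex.exp u)⁻¹ ≠ 0 := by
        intro h4
        apply h1
        have := sub_eq_zero.mp h4
        rw [← inv_inv (Complex.exp u), ← this, inv_one]
      have h5 : Complex.exp u - 1 ≠ 0 := sub_ne_zero.mpr h1
      have h6 : 1 - (Complex.exp u)⁻¹ = (Complex.exp u - 1) * (Complex.exp u)⁻¹ := by
        field_simp
      rw [h6, mul_inv, inv_inv]
      field_simp
      ring
  simp only [map_mul, map_inv₀, map_sub, map_one, ← Complex.exp_conj, map_add, map_neg, map_pow,
    map_div₀, Complex.conj_conj, Complex.conj_I, Complex.conj_ofReal, map_natCast, map_ofNat,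
    poleY]
  rw [key]
  push_cast
  rw [mul_neg, neg_inj, ← mul_assoc, ← Complex.exp_add, ← Complex.exp_add, ← Complex.exp_add]
  congr 1
  · congr 1
    ring_nf
    simp only [Complex.I_sq]
    ring
  · congr 3
    ring
end

section
/- With the notation of the context (h > 0, q = e^h, positive integers N, γ with N/γ an odd integer, β ∈ {0, 1/2}, a > 0, b ∈ ℝ, y_j = h(j+β) + iπ/γ), one has B_j^{a,b}(y) = − A_j^{a,b}(y) for every y ∈ ℝ. -/
open MeasureTheory Complex Real

/-- One has `B_j^{a,b}(y) = − A_j^{a,b}(y)` for every real `y`. -/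
theorem Bfun_eq_neg_Afun
    (h : ℝ) (hh : 0 < h) (N γ : ℕ) (hN : 0 < N) (hγ : 0 < γ)
    (hodd : ∃ p : ℕ, Odd p ∧ N = γ * p)
    (β : ℝ) (hβ : β = 0 ∨ β = 1 / 2)
    (a b : ℝ) (ha : 0 < a) (j : ℤ) :
    ∀ y : ℝ, Bfun h N γ β a b j y = - Afun h N γ β a b j y := by
  intro y
  obtain ⟨p, hp, rfl⟩ := hodd
  have hγ' : (γ : ℂ) ≠ 0 := by exact_mod_cast hγ.ne'
  have hE : Complex.exp (Complex.I * Real.pi * p) = -1 := by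
    rw [show Complex.I * (Real.pi : ℂ) * p = (p : ℂ) * (Real.pi * Complex.I) by ring,
      Complex.exp_nat_mul, Complex.exp_pi_mul_I, hp.neg_one_pow]
  have hE' : Complex.exp (-(Complex.I * Real.pi * p)) = -1 := by
    rw [Complex.exp_neg, hE]; norm_num
  have hconj : (starRingEnd ℂ) (poleY h β γ j)
      = ((h * (j + β) : ℝ) : ℂ) - Complex.I * Real.pi / γ := by
    simp only [poleY, map_add, map_div₀, map_mul, Complex.conj_ofReal, Complex.conj_I,
      Complex.conj_natCast]
    ring
  unfold Bfun Afun
  rw [hconj, ← integral_neg, ← integral_neg_eq_self]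
  congr 1
  funext ω
  unfold poleY
  generalize h * (j + β) = x
  have h1 : Complex.exp (((Real.pi / γ : ℝ) : ℂ) * (2 * ω - Complex.I * ((γ * p : ℕ) : ℂ)))
      = - Complex.exp (2 * (Real.pi / γ * ω : ℂ)) := by
    rw [show ((Real.pi / γ : ℝ) : ℂ) * (2 * ω - Complex.I * ((γ * p : ℕ) : ℂ))
      = 2 * (Real.pi / γ * ω : ℂ) + -(Complex.I * Real.pi * p) by push_cast; field_simp; ring,
      Complex.exp_add, hE']
    ring
  have h2 : Complex.exp (((Real.pi / γ : ℝ) : ℂ) *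
        (2 * ((-ω : ℝ) : ℂ) + Complex.I * ((γ * p : ℕ) : ℂ)))
      = - (Complex.exp (2 * (Real.pi / γ * ω : ℂ)))⁻¹ := by
    rw [show ((Real.pi / γ : ℝ) : ℂ) * (2 * ((-ω : ℝ) : ℂ) + Complex.I * ((γ * p : ℕ) : ℂ))
      = -(2 * (Real.pi / γ * ω : ℂ)) + (Complex.I * Real.pi * p) by push_cast; field_simp,
      Complex.exp_add, hE, Complex.exp_neg]
    ring
  have h3 : Complex.exp (((γ * p : ℕ) : ℂ) / 2 * ((x : ℂ) + Complex.I * Real.pi / γ)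
        - Complex.I * ((-ω : ℝ) : ℂ) * ((x : ℂ) + Complex.I * Real.pi / γ - y))
      = - (Complex.exp (((γ * p : ℕ) : ℂ) / 2 * ((x : ℂ) - Complex.I * Real.pi / γ)
        + Complex.I * ω * ((x : ℂ) - Complex.I * Real.pi / γ - y))
        * (Complex.exp (2 * (Real.pi / γ * ω : ℂ)))⁻¹) := by
    rw [← Complex.exp_neg, ← Complex.exp_add, ← neg_one_mul (Complex.exp _), ← hE, ← Complex.exp_add]
    congr 1
    push_cast
    field_simp
    ring_nf
    simp only [Complex.I_sq]
    ring
  have h4 : (((-ω : ℝ) : ℂ) - Complex.I * b) ^ 2 = ((ω : ℂ) + Complex.I * b) ^ 2 := by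
    push_cast; ring
  rw [h1, h2, h3, h4]
  have hpos : (1 : ℂ) + Complex.exp (2 * (Real.pi / γ * ω : ℂ)) ≠ 0 := by
    have : (1 : ℝ) + Real.exp (2 * (Real.pi / γ * ω)) ≠ 0 := by positivity
    exact_mod_cast this
  have hne := Complex.exp_ne_zero (2 * (Real.pi / γ * ω : ℂ))
  generalize Complex.exp (2 * (Real.pi / γ * ω : ℂ)) = T at *
  have h5 : T⁻¹ * (1 - -T⁻¹)⁻¹ = (1 - -T)⁻¹ := by
    rw [← mul_inv]
    congr 1
    field_simp
    ring
  rw [← h5]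
  ring
end

section
/- Let δ > 0, t ≥ 0 be real numbers and let ω ∈ (0,1). Then the family ( e^{−t(ω+2m)²} / sinh(δ(ω+2m)) )_{m∈ℤ} is absolutely summable, and its sum is strictly positive: Σ_{m∈ℤ} e^{−t(ω+2m)²} / sinh(δ(ω+2m)) > 0. -/
open Real

lemma skp_summable (δ t : ℝ) (hδ : 0 < δ) (ht : 0 ≤ t) (a : ℝ) (ha : 0 < a) :
    Summable (fun n : ℕ => Real.exp (-t * (a + 2 * n) ^ 2) / Real.sinh (δ * (a + 2 * n))) := by
  have hs : 0 < Real.sinh (δ * a) := Real.sinh_pos_iff.2 (mul_pos hδ ha)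
  have hg : Summable (fun n : ℕ => (Real.sinh (δ * a))⁻¹ * (Real.exp (-(2 * δ))) ^ n) := by
    apply Summable.mul_left
    apply summable_geometric_of_lt_one (Real.exp_pos _).le
    rw [Real.exp_lt_one_iff]
    linarith
  refine Summable.of_nonneg_of_le (fun n => ?_) (fun n => ?_) hg
  · have : 0 < Real.sinh (δ * (a + 2 * n)) := Real.sinh_pos_iff.2 (by positivity)
    positivity
  · have h0 : 0 ≤ Real.sinh (2 * δ * n) := Real.sinh_nonneg_iff.2 (by positivity)
    have h1 : Real.sinh (δ * a) * Real.exp (2 * δ * n) ≤ Real.sinh (δ * (a + 2 * n)) := by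
      rw [show δ * (a + 2 * n) = δ * a + 2 * δ * n by ring, Real.sinh_add,
        ← Real.cosh_add_sinh, mul_add]
      have := mul_le_mul_of_nonneg_right (Real.sinh_lt_cosh (δ * a)).le h0
      linarith
    have h2 : Real.exp (-t * (a + 2 * n) ^ 2) ≤ 1 := by
      rw [Real.exp_le_one_iff]
      have : 0 ≤ t * (a + 2 * n) ^ 2 := by positivity
      linarith
    calc _ ≤ 1 / (Real.sinh (δ * a) * Real.exp (2 * δ * n)) := by gcongr
      _ = _ := by
        rw [← Real.exp_nat_mul, show (n : ℝ) * -(2 * δ) = -(2 * δ * n) by ring, Real.exp_neg,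
          one_div, mul_inv]

/-- For `δ > 0`, `t ≥ 0` and `ω ∈ (0,1)`, the family
`(e^(−t(ω+2m)²) / sinh(δ(ω+2m)))_{m∈ℤ}` is absolutely summable and its sum is
strictly positive (positivity of the kernel `K(ω, y=0, δ, t)` for `C = sinh`). -/
theorem sinh_kernel_positive
    (δ t : ℝ) (hδ : 0 < δ) (ht : 0 ≤ t) (ω : ℝ) (hω : ω ∈ Set.Ioo (0 : ℝ) 1) :
    Summable (fun m : ℤ => |Real.exp (-t * (ω + 2 * m) ^ 2) / Real.sinh (δ * (ω + 2 * m))|) ∧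
    0 < ∑' m : ℤ, Real.exp (-t * (ω + 2 * m) ^ 2) / Real.sinh (δ * (ω + 2 * m)) := by
  obtain ⟨h0, h1⟩ := hω
  have hp := skp_summable δ t hδ ht ω h0
  have hm := skp_summable δ t hδ ht (2 - ω) (by linarith)
  set f : ℤ → ℝ := fun m => Real.exp (-t * (ω + 2 * m) ^ 2) / Real.sinh (δ * (ω + 2 * m)) with hf
  have e1 : ∀ n : ℕ, f n = Real.exp (-t * (ω + 2 * n) ^ 2) / Real.sinh (δ * (ω + 2 * n)) := by
    intro n
    simp [hf]
  have e2 : ∀ n : ℕ, f (-(n + 1)) =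
      -(Real.exp (-t * (2 - ω + 2 * n) ^ 2) / Real.sinh (δ * (2 - ω + 2 * n))) := by
    intro n
    simp only [hf]
    push_cast
    rw [show δ * (ω + 2 * (-((n : ℝ) + 1))) = -(δ * (2 - ω + 2 * n)) by ring, Real.sinh_neg, div_neg,
      show (ω + 2 * (-((n : ℝ) + 1))) ^ 2 = (2 - ω + 2 * n) ^ 2 by ring]
  have s1 : Summable (fun n : ℕ => f n) := by simpa only [e1] using hp
  have s2 : Summable (fun n : ℕ => f (-(n + 1))) := by simpa only [e2] using hm.neg
  refine ⟨(Summable.of_nat_of_neg_add_one s1 s2).abs, ?_⟩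
  rw [tsum_of_nat_of_neg_add_one s1 s2, ← s1.tsum_add s2]
  have hpos : ∀ n : ℕ, 0 < f n + f (-(n + 1)) := by
    intro n
    rw [e1, e2, ← sub_eq_add_neg, sub_pos]
    have hs : 0 < Real.sinh (δ * (ω + 2 * n)) := Real.sinh_pos_iff.2 (by positivity)
    have hlt : ω + 2 * (n : ℝ) < 2 - ω + 2 * n := by linarith
    have hs' : Real.sinh (δ * (ω + 2 * n)) < Real.sinh (δ * (2 - ω + 2 * n)) :=
      Real.sinh_lt_sinh.2 (mul_lt_mul_of_pos_left hlt hδ)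
    have he : Real.exp (-t * (2 - ω + 2 * n) ^ 2) ≤ Real.exp (-t * (ω + 2 * n) ^ 2) := by
      rw [Real.exp_le_exp]
      have : (ω + 2 * (n : ℝ)) ^ 2 ≤ (2 - ω + 2 * n) ^ 2 := by gcongr
      have := mul_le_mul_of_nonneg_left this ht
      linarith
    exact div_lt_div₀' he hs' (Real.exp_pos _) hs
  exact (s1.add s2).tsum_pos (fun n => (hpos n).le) 0 (hpos 0)
end

section
/- Let δ > 0, t ≥ 0 be real numbers and let ω ∈ ℝ. Then the family ( e^{−t(ω+2l)²} / ( cosh(δ(ω+2l)) · cosh(δ(ω+2(k+l))) ) )_{(l,k)∈ℤ²} is summable, its sum equals the product ( Σ_{l∈ℤ} e^{−t(ω+2l)²} / cosh(δ(ω+2l)) ) · ( Σ_{m∈ℤ} 1 / cosh(δ(ω+2m)) ), and this sum is strictly positive. -/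
open Real

lemma inv_cosh_le (x : ℝ) : 1 / Real.cosh x ≤ 2 * Real.exp (-x) := by
  rw [div_le_iff₀ (Real.cosh_pos x), Real.cosh_eq]
  have h : Real.exp (-x) * Real.exp x = 1 := by rw [← Real.exp_add]; simp
  nlinarith [Real.exp_pos (-x), mul_pos (Real.exp_pos (-x)) (Real.exp_pos (-x))]

lemma summable_nat_aux (δ ω : ℝ) (hδ : 0 < δ) :
    Summable (fun n : ℕ => 1 / Real.cosh (δ * (ω + 2 * (n : ℝ)))) := by
  have h1 : Summable (fun n : ℕ => 2 * Real.exp (-(δ * ω)) * Real.exp (n * (-(2 * δ)))) :=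
    (Real.summable_exp_nat_mul_iff.mpr (by linarith)).mul_left _
  refine Summable.of_nonneg_of_le (fun n => ?_) (fun n => ?_) h1
  · exact (one_div_pos.mpr (Real.cosh_pos _)).le
  · refine (inv_cosh_le _).trans (le_of_eq ?_)
    rw [mul_assoc, ← Real.exp_add]
    congr 2
    ring

lemma summable_int_aux (δ ω : ℝ) (hδ : 0 < δ) :
    Summable (fun m : ℤ => 1 / Real.cosh (δ * (ω + 2 * (m : ℝ)))) := by
  refine Summable.of_nat_of_neg ?_ ?_
  · simpa using summable_nat_aux δ ω hδ
  · refine (summable_nat_aux δ (-ω) hδ).congr (fun n => ?_)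
    rw [← Real.cosh_neg]
    congr 2
    push_cast
    ring

/-- For `δ > 0`, `t ≥ 0` and `ω ∈ ℝ`, the doubly indexed family
`(e^(−t(ω+2l)²) / (cosh(δ(ω+2l))·cosh(δ(ω+2(k+l)))))_{(l,k)∈ℤ²}` is summable, its sum
factorizes as the product of the two single sums, and it is strictly positive
(positivity of the kernel `K(ω, y=0, δ, t)` for `C = cosh`). -/
theorem cosh_kernel_positive
    (δ t : ℝ) (hδ : 0 < δ) (ht : 0 ≤ t) (ω : ℝ) :
    Summable (fun p : ℤ × ℤ =>
      Real.exp (-t * (ω + 2 * p.1) ^ 2) /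
        (Real.cosh (δ * (ω + 2 * p.1)) * Real.cosh (δ * (ω + 2 * (p.2 + p.1))))) ∧
    (∑' p : ℤ × ℤ,
        Real.exp (-t * (ω + 2 * p.1) ^ 2) /
          (Real.cosh (δ * (ω + 2 * p.1)) * Real.cosh (δ * (ω + 2 * (p.2 + p.1)))))
      = (∑' l : ℤ, Real.exp (-t * (ω + 2 * l) ^ 2) / Real.cosh (δ * (ω + 2 * l))) *
        (∑' m : ℤ, 1 / Real.cosh (δ * (ω + 2 * m))) ∧
    0 < ∑' p : ℤ × ℤ,
        Real.exp (-t * (ω + 2 * p.1) ^ 2) /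
          (Real.cosh (δ * (ω + 2 * p.1)) * Real.cosh (δ * (ω + 2 * (p.2 + p.1)))) := by
  have hg := summable_int_aux δ ω hδ
  have hgpos : ∀ m : ℤ, 0 < 1 / Real.cosh (δ * (ω + 2 * (m : ℝ))) :=
    fun m => one_div_pos.mpr (Real.cosh_pos _)
  have hfpos : ∀ l : ℤ, 0 < Real.exp (-t * (ω + 2 * (l : ℝ)) ^ 2) /
      Real.cosh (δ * (ω + 2 * (l : ℝ))) :=
    fun l => div_pos (Real.exp_pos _) (Real.cosh_pos _)
  have hf : Summable (fun l : ℤ => Real.exp (-t * (ω + 2 * (l : ℝ)) ^ 2) /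
      Real.cosh (δ * (ω + 2 * (l : ℝ)))) := by
    refine Summable.of_nonneg_of_le (fun l => (hfpos l).le) (fun l => ?_) hg
    refine div_le_div_of_nonneg_right ?_ (Real.cosh_pos _).le
    rw [Real.exp_le_one_iff]
    nlinarith [mul_nonneg ht (sq_nonneg (ω + 2 * (l : ℝ)))]
  have hfg := hf.mul_of_nonneg hg (fun l => (hfpos l).le) (fun l => (hgpos l).le)
  let e : ℤ × ℤ ≃ ℤ × ℤ := Equiv.prodShear (Equiv.refl ℤ) (fun l => Equiv.addRight l)
  have heq : (fun p : ℤ × ℤ =>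
      Real.exp (-t * (ω + 2 * p.1) ^ 2) /
        (Real.cosh (δ * (ω + 2 * p.1)) * Real.cosh (δ * (ω + 2 * (p.2 + p.1))))) =
      (fun x : ℤ × ℤ => Real.exp (-t * (ω + 2 * (x.1 : ℝ)) ^ 2) /
        Real.cosh (δ * (ω + 2 * (x.1 : ℝ))) * (1 / Real.cosh (δ * (ω + 2 * (x.2 : ℝ))))) ∘ e := by
    funext p
    simp only [Function.comp, e, Equiv.prodShear_apply, Equiv.refl_apply, Equiv.coe_addRight]
    push_cast
    rw [div_mul_div_comm, mul_one]
  have hs : Summable (fun p : ℤ × ℤ =>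
      Real.exp (-t * (ω + 2 * p.1) ^ 2) /
        (Real.cosh (δ * (ω + 2 * p.1)) * Real.cosh (δ * (ω + 2 * (p.2 + p.1))))) := by
    rw [heq]
    exact e.summable_iff.mpr hfg
  have hpos : ∀ p : ℤ × ℤ, 0 < Real.exp (-t * (ω + 2 * p.1) ^ 2) /
        (Real.cosh (δ * (ω + 2 * p.1)) * Real.cosh (δ * (ω + 2 * (p.2 + p.1)))) :=
    fun p => div_pos (Real.exp_pos _) (mul_pos (Real.cosh_pos _) (Real.cosh_pos _))
  refine ⟨hs, ?_, hs.tsum_pos (fun p => (hpos p).le) (0, 0) (hpos _)⟩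
  rw [hf.tsum_mul_tsum hg hfg, heq]
  exact e.tsum_eq (fun x : ℤ × ℤ => Real.exp (-t * (ω + 2 * (x.1 : ℝ)) ^ 2) /
        Real.cosh (δ * (ω + 2 * (x.1 : ℝ))) * (1 / Real.cosh (δ * (ω + 2 * (x.2 : ℝ)))))
end
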